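/- Let (C, μ) be an MV pattern and let (c_j, c_{j+1}) be an adjacent pair of creases with c_j − c_{j−1} ≥ c_{j+1} − c_j, c_{j+2} − c_{j+1} ≥ c_{j+1} − c_j, and μ(c_j) ≠ μ(c_{j+1}). Then (C, μ) is flat-foldable if and only if the crease pattern produced by the monocrimp at (c_j, c_{j+1}), with the induced assignment on its remaining creases, is flat-foldable. -/

import Mathlib

/-- Mountain or valley label for a crease. -/
inductive MV : Type
  | M : MV
  | V : MV
deriving DecidableEq

/-- `(c 0, c 1, …, c n)` is a 1D crease pattern: a strictly increasing finite
sequence of reals with `n ≥ 1`.  The points `c 1, …, c (n-1)` are its creases,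
`c 0` and `c n` its ends. -/
def IsCreasePattern (n : ℕ) (c : ℕ → ℝ) : Prop :=
  1 ≤ n ∧ ∀ i j : ℕ, i < j → j ≤ n → c i < c j

/-- The consecutive creases `(c i, …, c (i+k))` form a crimpable sequence with gap `d`. -/
def IsCrimpable (n : ℕ) (c : ℕ → ℝ) (i k : ℕ) (d : ℝ) : Prop :=
  1 ≤ i ∧ 1 ≤ k ∧ i + k ≤ n - 1 ∧
  (∀ m : ℕ, i ≤ m → m < i + k → c (m + 1) - c m = d) ∧
  d < c i - c (i - 1) ∧ d < c (i + k + 1) - c (i + k)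

/-- Additive offset of the folded-position map on the `j`-th interval:
on `[c j, c (j+1)]` the folded-position map is `x ↦ (-1)^j * x + foldOffset c j`. -/
def foldOffset (c : ℕ → ℝ) : ℕ → ℝ
  | 0 => 0
  | j + 1 => foldOffset c (j) + 2 * (-1 : ℝ) ^ j * c (j + 1)

/-- Folded position of a point `x` belonging to the `j`-th interval `[c j, c (j+1)]`.
This is the unique continuous map equal to the identity on `[c 0, c 1]`, isometric on
every interval, and reversing direction at every crease. -/
def foldPos (c : ℕ → ℝ) (j : ℕ) (x : ℝ) : ℝ := (-1 : ℝ) ^ j * x + foldOffset c j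

/-- Folded position of the crease `c i`. -/
def foldCrease (c : ℕ → ℝ) (i : ℕ) : ℝ := foldPos c i (c i)

/-- `x` lies strictly `lt`-between `a` and `b`. -/
def Between (lt : ℕ → ℕ → Prop) (a b x : ℕ) : Prop :=
  (lt a x ∧ lt x b) ∨ (lt b x ∧ lt x a)

/-- The MV pattern `(C, μ)` is flat-foldable: there is a strict linear order `lt`
("strictly below") on the intervals `I_0, …, I_{n-1}` (indexed `0, …, n-1`) such that:
(i) for each crease `i`, `I_{i-1}` is below `I_i` iff either `μ i = V` and the folded map
is increasing on `I_{i-1}` (slope `(-1)^(i-1) = 1`), or `μ i = M` and it is decreasing;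
(ii) for each crease `i` and each interval `J` whose folded image contains the folded
crease position in its interior, `J` is not strictly between `I_{i-1}` and `I_i`;
(iii) for distinct creases `i, j` folding to the same point, it is not the case that
exactly one of `I_{j-1}`, `I_j` is strictly between `I_{i-1}` and `I_i`. -/
def IsFlatFoldable (n : ℕ) (c : ℕ → ℝ) (μ : ℕ → MV) : Prop :=
  ∃ lt : ℕ → ℕ → Prop,
    (∀ j, j < n → ¬ lt j j) ∧
    (∀ a b e, lt a b → lt b e → lt a e) ∧
    (∀ a b, a < n → b < n → a ≠ b → lt a b ∨ lt b a) ∧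
    (∀ a b, lt a b → a < n ∧ b < n) ∧
    (∀ i, 1 ≤ i → i ≤ n - 1 →
      (lt (i - 1) i ↔ ((μ i = MV.V ∧ Even (i - 1)) ∨ (μ i = MV.M ∧ Odd (i - 1))))) ∧
    (∀ i, 1 ≤ i → i ≤ n - 1 → ∀ j, j < n →
      foldCrease c i ∈
        Set.Ioo (min (foldPos c j (c j)) (foldPos c j (c (j + 1))))
                (max (foldPos c j (c j)) (foldPos c j (c (j + 1)))) →
      ¬ Between lt (i - 1) i j) ∧
    (∀ i j, 1 ≤ i → i ≤ n - 1 → 1 ≤ j → j ≤ n - 1 → i ≠ j →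
      foldCrease c i = foldCrease c j →
      (Between lt (i - 1) i (j - 1) ↔ Between lt (i - 1) i j))

/-- `F` is a forcing set for the MV pattern `(C, μ)`: a set of creases such that the only
flat-foldable assignment agreeing with `μ` on `F` is `μ` itself (on all creases). -/
def IsForcingSet (n : ℕ) (c : ℕ → ℝ) (μ : ℕ → MV) (F : Set ℕ) : Prop :=
  F ⊆ Set.Icc 1 (n - 1) ∧
  ∀ ν : ℕ → MV, IsFlatFoldable n c ν → (∀ x ∈ F, ν x = μ x) →
    ∀ x, 1 ≤ x → x ≤ n - 1 → ν x = μ x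

/-- The crease pattern produced by a monocrimp at the adjacent pair `(c j, c (j+1))`:
it deletes `c j` and `c (j+1)` and translates all later points by `-2 * (c (j+1) - c j)`. -/
def monocrimpPattern (c : ℕ → ℝ) (j : ℕ) : ℕ → ℝ :=
  fun x => if x < j then c x else c (x + 2) - 2 * (c (j + 1) - c j)

/-- A height function `h` on the layers `0, …, n-1` of a folding whose vertices fold to
`P 0, …, P n` which separates the layers and makes no layer or crease cross a crease. -/
def IsLayering (n : ℕ) (P : ℕ → ℝ) (h : ℕ → ℤ) : Prop :=
  (∀ a b, a < n → b < n → h a = h b → a = b) ∧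
  (∀ i, 1 ≤ i → i < n → ∀ k, k < n →
    (P k < P i ∧ P i < P (k + 1)) ∨ (P (k + 1) < P i ∧ P i < P k) →
      ¬ Between (fun a b => h a < h b) (i - 1) i k) ∧
  (∀ i k, 1 ≤ i → i < n → 1 ≤ k → k < n → i ≠ k → P i = P k →
    (Between (fun a b => h a < h b) (i - 1) i (k - 1) ↔
      Between (fun a b => h a < h b) (i - 1) i k))

theorem foldPos_succ_eq_foldCrease (c : ℕ → ℝ) (k : ℕ) :
    foldPos c k (c (k + 1)) = foldCrease c (k + 1) := by
  simp only [foldCrease, foldPos, foldOffset, pow_succ]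
  ring

theorem foldCrease_succ (c : ℕ → ℝ) (k : ℕ) :
    foldCrease c (k + 1) = foldCrease c k + (-1) ^ k * (c (k + 1) - c k) := by
  simp only [foldCrease, foldPos, foldOffset, pow_succ]
  ring

theorem mem_Ioo_min_max_iff (a b x : ℝ) :
    x ∈ Set.Ioo (min a b) (max a b) ↔ (a < x ∧ x < b) ∨ (b < x ∧ x < a) := by
  rcases le_total a b with hab | hab
  · simp only [min_eq_left hab, max_eq_right hab, Set.mem_Ioo]
    refine ⟨Or.inl, fun hx => hx.elim id fun hx => ?_⟩
    exact absurd (hx.1.trans hx.2) hab.not_gt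
  · simp only [min_eq_right hab, max_eq_left hab, Set.mem_Ioo]
    refine ⟨Or.inr, fun hx => hx.elim (fun hx => ?_) id⟩
    exact absurd (hx.1.trans hx.2) hab.not_gt

/-- A strict linear order on `0, …, n-1` is induced by an integer-valued height. -/
theorem exists_height (n : ℕ) (lt : ℕ → ℕ → Prop)
    (hirr : ∀ j, j < n → ¬ lt j j) (htr : ∀ a b e, lt a b → lt b e → lt a e)
    (htot : ∀ a b, a < n → b < n → a ≠ b → lt a b ∨ lt b a) :
    ∃ h : ℕ → ℤ, ∀ a b, a < n → b < n → (lt a b ↔ h a < h b) := by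
  classical
  let s : ℕ → Finset ℕ := fun a => (Finset.range n).filter fun x => lt x a
  have hlt : ∀ a b, a < n → lt a b → (s a).card < (s b).card := by
    intro a b ha hab
    apply Finset.card_lt_card
    rw [Finset.ssubset_iff_of_subset]
    · exact ⟨a, by simp [s, ha, hab], by simp [s, hirr a ha]⟩
    · intro x hx
      simp only [s, Finset.mem_filter] at hx ⊢
      exact ⟨hx.1, htr _ _ _ hx.2 hab⟩
  refine ⟨fun a => ((s a).card : ℤ), fun a b ha hb => ⟨fun hab => ?_, fun hab => ?_⟩⟩
  · exact Int.ofNat_lt.2 (hlt a b ha hab)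
  · have hab' : (s a).card < (s b).card := Int.ofNat_lt.1 hab
    by_contra hn
    by_cases hne : a = b
    · subst hne
      exact lt_irrefl _ hab'
    · have := hlt b a hb ((htot a b ha hb hne).resolve_left hn)
      omega

theorem isFlatFoldable_iff_exists_isLayering (n : ℕ) (c : ℕ → ℝ) (μ : ℕ → MV) :
    IsFlatFoldable n c μ ↔ ∃ h : ℕ → ℤ, IsLayering n (foldCrease c) h ∧
      ∀ i, 1 ≤ i → i < n →
        (h (i - 1) < h i ↔ ((μ i = MV.V ∧ Even (i - 1)) ∨ (μ i = MV.M ∧ Odd (i - 1)))) := by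
  have transfer : ∀ (lt : ℕ → ℕ → Prop) (h : ℕ → ℤ),
      (∀ a b, a < n → b < n → (lt a b ↔ h a < h b)) → ∀ a b x, a < n → b < n → x < n →
        (Between lt a b x ↔ Between (fun a b => h a < h b) a b x) := by
    intro lt h hh a b x ha hb hx
    simp only [Between, hh a x ha hx, hh x b hx hb, hh b x hb hx, hh x a hx ha]
  constructor
  · rintro ⟨lt, hirr, htr, htot, -, h1, h2, h3⟩
    obtain ⟨h, hh⟩ := exists_height n lt hirr htr htot
    have tr := transfer lt h hh
    refine ⟨h, ⟨?_, ?_, ?_⟩, ?_⟩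
    · intro a b ha hb hab
      by_contra hne
      have := htot a b ha hb hne
      rw [hh a b ha hb, hh b a hb ha] at this
      omega
    · intro i hi hin k hk hmem
      rw [← tr (i - 1) i k (by omega) hin hk]
      refine h2 i hi (by omega) k hk ?_
      rw [foldPos_succ_eq_foldCrease, mem_Ioo_min_max_iff]
      exact hmem
    · intro i k hi hin hk hkn hik hP
      rw [← tr (i - 1) i k (by omega) hin hkn,
        ← tr (i - 1) i (k - 1) (by omega) hin (by omega)]
      exact h3 i k hi (by omega) hk (by omega) hik hP
    · intro i hi hin
      rw [← hh (i - 1) i (by omega) hin]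
      exact h1 i hi (by omega)
  · rintro ⟨h, ⟨hinj, h2, h3⟩, h1⟩
    let lt : ℕ → ℕ → Prop := fun a b => a < n ∧ b < n ∧ h a < h b
    have hh : ∀ a b, a < n → b < n → (lt a b ↔ h a < h b) := fun a b ha hb => by
      simp [lt, ha, hb]
    have tr := transfer lt h hh
    refine ⟨lt, ?_, ?_, ?_, ?_, ?_, ?_, ?_⟩
    · rintro k - ⟨-, -, hk⟩
      exact lt_irrefl _ hk
    · rintro a b e ⟨ha, -, hab⟩ ⟨-, he, hbe⟩
      exact ⟨ha, he, hab.trans hbe⟩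
    · intro a b ha hb hab
      rw [hh a b ha hb, hh b a hb ha]
      exact lt_or_gt_of_ne fun e => hab (hinj a b ha hb e)
    · rintro a b ⟨ha, hb, -⟩
      exact ⟨ha, hb⟩
    · intro i hi hin
      rw [hh (i - 1) i (by omega) (by omega)]
      exact h1 i hi (by omega)
    · intro i hi hin k hk hmem
      rw [tr (i - 1) i k (by omega) (by omega) hk]
      refine h2 i hi (by omega) k hk ?_
      rw [foldPos_succ_eq_foldCrease, mem_Ioo_min_max_iff] at hmem
      exact hmem
    · intro i k hi hin hk hkn hik hP
      rw [tr (i - 1) i k (by omega) (by omega) (by omega),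
        tr (i - 1) i (k - 1) (by omega) (by omega) (by omega)]
      exact h3 i k hi (by omega) hk (by omega) hik hP

theorem IsLayering.neg_left {n : ℕ} {P : ℕ → ℝ} {h : ℕ → ℤ} (H : IsLayering n P h) :
    IsLayering n (fun k => -P k) h := by
  obtain ⟨h1, h2, h3⟩ := H
  refine ⟨h1, fun i hi hin k hk hmem => h2 i hi hin k hk ?_,
    fun i k hi hin hk hkn hik hP => h3 i k hi hin hk hkn hik (neg_injective hP)⟩
  simp only [neg_lt_neg_iff] at hmem
  tauto

theorem IsLayering.neg_right {n : ℕ} {P : ℕ → ℝ} {h : ℕ → ℤ} (H : IsLayering n P h) :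
    IsLayering n P (fun k => -h k) := by
  obtain ⟨h1, h2, h3⟩ := H
  have hb : ∀ a b x, Between (fun a b => -h a < -h b) a b x ↔
      Between (fun a b => h a < h b) a b x := by
    intro a b x
    simp only [Between, neg_lt_neg_iff]
    tauto
  refine ⟨fun a b ha hb hab => h1 a b ha hb (neg_injective hab), ?_, ?_⟩
  · simpa only [hb] using h2
  · simpa only [hb] using h3

/-- Index of a vertex of the monocrimped pattern in the original pattern. -/
def uncrimp (j x : ℕ) : ℕ := if x < j then x else x + 2

theorem foldOffset_monocrimpPattern_of_lt (c : ℕ → ℝ) (j k : ℕ) (hk : k < j) :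
    foldOffset (monocrimpPattern c j) k = foldOffset c k := by
  induction k with
  | zero => rfl
  | succ k ih => simp [foldOffset, ih (by omega), monocrimpPattern, hk]

theorem foldOffset_monocrimpPattern_of_ge (c : ℕ → ℝ) (j k : ℕ) (hj : 1 ≤ j) (hk : j ≤ k + 1) :
    foldOffset (monocrimpPattern c j) k =
      foldOffset c (k + 2) + 2 * (c (j + 1) - c j) * (-1) ^ k := by
  induction k, (show j - 1 ≤ k by omega) using Nat.le_induction with
  | base =>
    rw [foldOffset_monocrimpPattern_of_lt c j _ (by omega)]
    obtain ⟨i, rfl⟩ : ∃ i, j = i + 1 := ⟨j - 1, by omega⟩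
    simp only [Nat.add_sub_cancel, foldOffset, pow_succ]
    ring
  | succ k hk' ih =>
    have : ¬ k + 1 < j := by omega
    simp only [foldOffset, ih (by omega), monocrimpPattern, this, if_false, pow_succ]
    ring

theorem foldCrease_monocrimpPattern (c : ℕ → ℝ) (j : ℕ) (hj : 1 ≤ j) :
    foldCrease (monocrimpPattern c j) = fun k => foldCrease c (uncrimp j k) := by
  funext k
  by_cases hk : k < j
  · simp [foldCrease, foldPos, foldOffset_monocrimpPattern_of_lt c j k hk, monocrimpPattern,
      uncrimp, hk]
  · simp only [foldCrease, foldPos, foldOffset_monocrimpPattern_of_ge c j k hj (by omega),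
      monocrimpPattern, uncrimp, hk, if_false, pow_succ]
    ring

/-- Replacing the layer `j - 1` of a layering of the monocrimped pattern by three consecutive
layers gives a layering of the original pattern. -/
theorem IsLayering.of_uncrimp {n j : ℕ} {P : ℕ → ℝ} {h : ℕ → ℤ} (hj : 1 ≤ j) (hjn : j + 1 < n)
    (h0 : P (j - 1) ≤ P (j + 1)) (h1 : P (j + 1) < P j) (h2 : P j ≤ P (j + 2))
    (H : IsLayering (n - 2) (fun k => P (uncrimp j k)) h) :
    ∃ g : ℕ → ℤ, IsLayering n P g ∧ g (j - 1) < g j ∧ g j < g (j + 1) ∧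
      ∀ i, 1 ≤ i → i < n - 2 → (g (uncrimp j i - 1) < g (uncrimp j i) ↔ h (i - 1) < h i) := by
  obtain ⟨hinj, hcl, hcc⟩ := H
  let π : ℕ → ℕ := fun x => if x < j then x else if x ≤ j + 1 then j - 1 else x - 2
  let t : ℕ → ℤ := fun x => if x = j - 1 then -1 else if x = j + 1 then 1 else 0
  let g : ℕ → ℤ := fun x => 3 * h (π x) + t x
  have ht : ∀ x, -1 ≤ t x ∧ t x ≤ 1 := by
    intro x; simp only [t]; split_ifs <;> simp
  have hπ : ∀ x, x < n → π x < n - 2 := by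
    intro x hx; simp only [π]; split_ifs <;> omega
  have hgπ : ∀ x y, x < n → y < n → (x = y ∨ π x ≠ π y) → (g x < g y ↔ h (π x) < h (π y)) := by
    intro x y hx hy hxy
    rcases hxy with rfl | hxy
    · simp
    · have h3 : h (π x) ≠ h (π y) := fun e => hxy (hinj _ _ (hπ x hx) (hπ y hy) e)
      have := ht x
      have := ht y
      simp only [g]
      omega
  have hπeq : ∀ x y, π x = π y → x = y ∨ ((x = j - 1 ∨ x = j ∨ x = j + 1) ∧
      (y = j - 1 ∨ y = j ∨ y = j + 1)) := by
    intro x y; simp only [π]; split_ifs <;> omega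
  have gA : g (j - 1) = 3 * h (j - 1) - 1 := by
    have : π (j - 1) = j - 1 := by simp only [π]; split_ifs <;> omega
    have : t (j - 1) = -1 := by simp [t]
    simp only [g, *]; ring
  have gB : g j = 3 * h (j - 1) := by
    have : π j = j - 1 := by simp [π]
    have : t j = 0 := by simp only [t]; split_ifs <;> omega
    simp only [g, *]; ring
  have gC : g (j + 1) = 3 * h (j - 1) + 1 := by
    have : π (j + 1) = j - 1 := by simp [π]
    have : t (j + 1) = 1 := by simp only [t]; split_ifs <;> omega
    simp only [g, *]
  have gO : ∀ x, x < n → x ≠ j - 1 → x ≠ j → x ≠ j + 1 →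
      g x = 3 * h (π x) ∧ h (π x) ≠ h (j - 1) := by
    intro x hx ha hb hc
    refine ⟨by simp [g, t, ha, hc], fun e => ?_⟩
    have := hinj _ _ (hπ x hx) (by omega) e
    simp only [π] at this
    split_ifs at this <;> omega
  -- creases of the original pattern other than the crimped ones come from the new pattern
  have hcr : ∀ i, 1 ≤ i → i < n → i ≠ j → i ≠ j + 1 → ∃ e, 1 ≤ e ∧ e < n - 2 ∧
      uncrimp j e = i ∧ π (i - 1) = e - 1 ∧ π i = e := by
    intro i hi hin hij hij'
    refine ⟨if i < j then i else i - 2, ?_⟩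
    simp only [uncrimp, π]
    split_ifs <;> omega
  have hgAt : ∀ i, 1 ≤ i → i < n → i ≠ j → i ≠ j + 1 → (i - 1 = i ∨ π (i - 1) ≠ π i) := by
    intro i hi hin hij hij'
    obtain ⟨e, he, hen, rfl, he1, he2⟩ := hcr i hi hin hij hij'
    omega
  have hnone : ∀ i, (i = j ∨ i = j + 1) → ∀ x, ¬ Between (fun a b => g a < g b) (i - 1) i x := by
    intro i hi x
    simp only [Between]
    rcases hi with rfl | rfl
    · omega
    · simp only [Nat.add_sub_cancel]; omega
  have hstar : P (uncrimp j (j - 1)) = P (j - 1) := by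
    have : j - 1 < j := by omega
    simp [uncrimp, this]
  have hstar' : P (uncrimp j (j - 1 + 1)) = P (j + 2) := by
    have : j - 1 + 1 = j := by omega
    simp [uncrimp, this]
  refine ⟨g, ⟨?_, ?_, ?_⟩, by omega, by omega, ?_⟩
  · intro a b ha hb hab
    by_contra hne
    by_cases hp : π a = π b
    · rcases hπeq a b hp with e | ⟨e1, e2⟩
      · exact hne e
      · rcases e1 with rfl | rfl | rfl <;> rcases e2 with rfl | rfl | rfl <;> omega
    · have h3 : h (π a) ≠ h (π b) := fun e => hp (hinj _ _ (hπ a ha) (hπ b hb) e)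
      have := ht a
      have := ht b
      simp only [g] at hab
      omega
  · intro i hi hin k hk hmem hbt
    by_cases hij : i = j ∨ i = j + 1
    · exact hnone i hij k hbt
    push Not at hij
    obtain ⟨e, he, hen, hei, he1, he2⟩ := hcr i hi hin hij.1 hij.2
    have hmem' : (P (uncrimp j (π k)) < P i ∧ P i < P (uncrimp j (π k + 1))) ∨
        (P (uncrimp j (π k + 1)) < P i ∧ P i < P (uncrimp j (π k))) := by
      by_cases hkt : k = j - 1 ∨ k = j ∨ k = j + 1
      · have hk1 : π k = j - 1 := by
          simp only [π]; split_ifs <;> omega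
        rw [hk1, hstar, hstar']
        left
        have e1 : j - 1 + 1 = j := by omega
        have e2 : j + 1 + 1 = j + 2 := rfl
        rcases hkt with rfl | rfl | rfl
        · rw [e1] at hmem; rcases hmem with hm | hm <;> constructor <;> linarith [hm.1, hm.2]
        · rcases hmem with hm | hm <;> constructor <;> linarith [hm.1, hm.2]
        · rw [e2] at hmem; rcases hmem with hm | hm <;> constructor <;> linarith [hm.1, hm.2]
      · have e1 : uncrimp j (π k) = k := by
          simp only [π, uncrimp]; split_ifs <;> omega
        have e2 : uncrimp j (π k + 1) = k + 1 := by
          simp only [π, uncrimp]; split_ifs <;> omega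
        rwa [e1, e2]
    refine hcl e he hen (π k) (hπ k hk) (by simpa only [hei] using hmem') ?_
    have key : ∀ x, (x = i - 1 ∨ x = i) → (x = k ∨ π x ≠ π k) := by
      intro x hx
      by_contra! hcon
      rcases hπeq x k hcon.2 with e3 | ⟨e3, -⟩
      · exact hcon.1 e3
      · have hk1 : π k = j - 1 := by
          rw [← hcon.2]; simp only [π]; split_ifs <;> omega
        have : i = j - 1 ∨ i = j + 2 := by omega
        rw [hk1, hstar, hstar'] at hmem'
        rcases this with rfl | rfl
        · rcases hmem' with hm | hm <;> linarith [hm.1, hm.2]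
        · rcases hmem' with hm | hm <;> linarith [hm.1, hm.2]
    have k1 := key _ (Or.inl rfl)
    have k2 := key _ (Or.inr rfl)
    have k1' : k = i - 1 ∨ π k ≠ π (i - 1) := k1.imp Eq.symm Ne.symm
    have k2' : k = i ∨ π k ≠ π i := k2.imp Eq.symm Ne.symm
    simpa only [Between, hgπ _ _ (show i - 1 < n by omega) hk k1, hgπ _ _ hin hk k2,
      hgπ _ _ hk (show i - 1 < n by omega) k1', hgπ _ _ hk hin k2', he1, he2] using hbt
  · intro i k hi hin hk hkn hik hP
    by_cases hij : i = j ∨ i = j + 1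
    · exact iff_of_false (hnone i hij _) (hnone i hij _)
    push Not at hij
    by_cases hkj : k = j ∨ k = j + 1
    · by_cases hi1 : i = j - 1
      · have hk1 : k = j + 1 := by
          rcases hkj with rfl | rfl
          · rw [hi1] at hP; linarith
          · rfl
        subst hk1 hi1
        have := gO (j - 1 - 1) (by omega) (by omega) (by omega) (by omega)
        simp only [Between, Nat.add_sub_cancel]
        omega
      · by_cases hi2 : i = j + 2
        · have hk1 : k = j := by
            rcases hkj with rfl | rfl
            · rfl
            · rw [hi2] at hP; linarith
          subst hk1 hi2
          have := gO (k + 2) (by omega) (by omega) (by omega) (by omega)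
          have e1 : k + 2 - 1 = k + 1 := rfl
          simp only [Between, e1]
          omega
        · have a1 := gO (i - 1) (by omega) (by omega) (by omega) (by omega)
          have a2 := gO i (by omega) (by omega) (by omega) (by omega)
          simp only [Between]
          rcases hkj with rfl | rfl
          · omega
          · simp only [Nat.add_sub_cancel]; omega
    push Not at hkj
    obtain ⟨e, he, hen, hei, he1, he2⟩ := hcr i hi hin hij.1 hij.2
    obtain ⟨f, hf, hfn, hfk, hf1, hf2⟩ := hcr k hk hkn hkj.1 hkj.2
    have hef : e ≠ f := by rintro rfl; omega
    have := hcc e f he hen hf hfn hef (by simpa only [hei, hfk] using hP)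
    have key : ∀ x y, (x = i - 1 ∨ x = i) → (y = k - 1 ∨ y = k) → (x = y ∨ π x ≠ π y) := by
      intro x y hx hy
      by_contra! hcon
      rcases hπeq x y hcon.2 with e3 | ⟨e3, e4⟩
      · exact hcon.1 e3
      · have : (i = j - 1 ∧ k = j + 2) ∨ (i = j + 2 ∧ k = j - 1) := by omega
        rcases this with ⟨rfl, rfl⟩ | ⟨rfl, rfl⟩ <;> linarith
    have key' : ∀ x y, (x = i - 1 ∨ x = i) → (y = k - 1 ∨ y = k) → (y = x ∨ π y ≠ π x) :=
      fun x y hx hy => (key x y hx hy).imp Eq.symm Ne.symm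
    have hi' : i - 1 < n := by omega
    have hk' : k - 1 < n := by omega
    simpa only [Between, he1, he2, hf1, hf2,
      hgπ _ _ hi' hk' (key _ _ (Or.inl rfl) (Or.inl rfl)),
      hgπ _ _ hi' hkn (key _ _ (Or.inl rfl) (Or.inr rfl)),
      hgπ _ _ hin hk' (key _ _ (Or.inr rfl) (Or.inl rfl)),
      hgπ _ _ hin hkn (key _ _ (Or.inr rfl) (Or.inr rfl)),
      hgπ _ _ hk' hi' (key' _ _ (Or.inl rfl) (Or.inl rfl)),
      hgπ _ _ hkn hi' (key' _ _ (Or.inl rfl) (Or.inr rfl)),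
      hgπ _ _ hk' hin (key' _ _ (Or.inr rfl) (Or.inl rfl)),
      hgπ _ _ hkn hin (key' _ _ (Or.inr rfl) (Or.inr rfl))] using this
  · intro i hi hin
    have h3 : uncrimp j i ≠ j ∧ uncrimp j i ≠ j + 1 ∧ 1 ≤ uncrimp j i ∧ uncrimp j i < n := by
      simp only [uncrimp]; split_ifs <;> omega
    rw [hgπ _ _ (by omega) h3.2.2.2 (hgAt _ h3.2.2.1 h3.2.2.2 h3.1 h3.2.1)]
    have e1 : π (uncrimp j i) = i := by
      simp only [π, uncrimp]; split_ifs <;> omega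
    have e2 : π (uncrimp j i - 1) = i - 1 := by
      simp only [π, uncrimp]; split_ifs <;> omega
    rw [e1, e2]

/-- The heights `g` are obtained from the heights `h` by a map which is monotone on the class `Q`
and on its complement, and which places `Q` in a gap `(lo, hi)` of the complement. -/
structure IsGapMap (m : ℕ) (g h : ℕ → ℤ) (Q : ℕ → Prop) (lo hi : ℤ) : Prop where
  mem : ∀ x, x < m → Q x → lo < g x ∧ g x < hi
  notMem : ∀ x, x < m → ¬ Q x → g x ≤ lo ∨ hi ≤ g x
  lt_iff : ∀ x y, x < m → y < m → (Q x ↔ Q y) → (g x < g y ↔ h x < h y)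

theorem IsGapMap.between_iff {m : ℕ} {g h : ℕ → ℤ} {Q : ℕ → Prop} {lo hi : ℤ}
    (H : IsGapMap m g h Q lo hi) {a b x : ℕ} (ha : a < m) (hb : b < m) (hx : x < m)
    (hab : Q a ↔ Q b) (hax : Q a ↔ Q x) :
    Between (fun a b => g a < g b) a b x ↔ Between (fun a b => h a < h b) a b x := by
  simp only [Between, H.lt_iff a x ha hx hax, H.lt_iff x a hx ha hax.symm,
    H.lt_iff x b hx hb (hax.symm.trans hab), H.lt_iff b x hb hx (hab.symm.trans hax)]

theorem IsGapMap.not_between {m : ℕ} {g h : ℕ → ℤ} {Q : ℕ → Prop} {lo hi : ℤ}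
    (H : IsGapMap m g h Q lo hi) {a b x : ℕ} (ha : a < m) (hb : b < m) (hx : x < m)
    (hab : Q a ↔ Q b) (hbt : ¬ Between (fun a b => h a < h b) a b x)
    (hgap : Q x → ¬ Q a → ¬ Q b →
      ¬ (g a ≤ lo ∧ hi ≤ g b) ∧ ¬ (g b ≤ lo ∧ hi ≤ g a)) :
    ¬ Between (fun a b => g a < g b) a b x := by
  by_cases hax : Q a ↔ Q x
  · rwa [H.between_iff ha hb hx hab hax]
  · by_cases h1 : Q a
    · have h2 := H.mem a ha h1
      have h3 := H.mem b hb (hab.1 h1)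
      have h4 := H.notMem x hx (by tauto)
      simp only [Between]
      clear hgap hbt
      omega
    · have h2 := H.notMem a ha h1
      have h3 := H.notMem b hb (by tauto)
      have h4 := H.mem x hx (by tauto)
      have h5 := hgap (by tauto) h1 (by tauto)
      simp only [Between]
      clear hgap hbt
      omega

theorem IsGapMap.between_iff_between {m : ℕ} {g h : ℕ → ℤ} {Q : ℕ → Prop} {lo hi : ℤ}
    (H : IsGapMap m g h Q lo hi) {a b x y : ℕ} (ha : a < m) (hb : b < m) (hx : x < m) (hy : y < m)
    (hab : Q a ↔ Q b) (hxy : Q x ↔ Q y)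
    (hbt : Between (fun a b => h a < h b) a b x ↔ Between (fun a b => h a < h b) a b y) :
    Between (fun a b => g a < g b) a b x ↔ Between (fun a b => g a < g b) a b y := by
  by_cases hax : Q a ↔ Q x
  · rwa [H.between_iff ha hb hx hab hax, H.between_iff ha hb hy hab (hax.trans hxy)]
  · clear hbt
    simp only [Between]
    by_cases h1 : Q a
    · have h2 := H.mem a ha h1
      have h3 := H.mem b hb (hab.1 h1)
      have h4 := H.notMem x hx (by tauto)
      have h5 := H.notMem y hy (by tauto)
      exact iff_of_false (by omega) (by omega)
    · have h2 := H.notMem a ha h1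
      have h3 := H.notMem b hb (by tauto)
      have h4 := H.mem x hx (by tauto)
      have h5 := H.mem y hy (by tauto)
      constructor <;> omega

/-- A layering of a pattern with a crimp at `j, j + 1`, normalized so that the layers
`j - 1, j, j + 1` are stacked in this order and the folding is increasing on layer `j - 1`. -/
structure IsPleat (n j : ℕ) (P : ℕ → ℝ) (h : ℕ → ℤ) : Prop where
  one_le : 1 ≤ j
  lt : j + 1 < n
  le_snd : P (j - 1) ≤ P (j + 1)
  snd_lt_fst : P (j + 1) < P j
  fst_le : P j ≤ P (j + 2)
  side : ∀ i, i + 1 < n →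
    (P i < P (i + 1) ∧ P (i + 2) < P (i + 1)) ∨ (P (i + 1) < P i ∧ P (i + 1) < P (i + 2))
  layering : IsLayering n P h
  height_lt : h (j - 1) < h j
  lt_height : h j < h (j + 1)

/-- The layers enclosed in the pleat which enter it from the right. -/
def EntersRight (j : ℕ) (P : ℕ → ℝ) (h : ℕ → ℤ) (x : ℕ) : Prop :=
  (h (j - 1) < h x ∧ h x < h j ∧ P j ≤ P x ∧ P j ≤ P (x + 1)) ∨
    (h j < h x ∧ h x < h (j + 1) ∧ P (j + 1) ≤ P x ∧ P (j + 1) ≤ P (x + 1))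

/-- The layers enclosed in the pleat which enter it from the left. -/
def EntersLeft (j : ℕ) (P : ℕ → ℝ) (h : ℕ → ℤ) (x : ℕ) : Prop :=
  (h (j - 1) < h x ∧ h x < h j ∧ P x ≤ P j ∧ P (x + 1) ≤ P j) ∨
    (h j < h x ∧ h x < h (j + 1) ∧ P x ≤ P (j + 1) ∧ P (x + 1) ≤ P (j + 1))

namespace IsPleat

variable {n j : ℕ} {P : ℕ → ℝ} {h : ℕ → ℤ}

theorem ne_succ (H : IsPleat n j P h) {x : ℕ} (hx : x < n) : P x ≠ P (x + 1) := by
  rcases Nat.lt_or_ge (x + 1) n with hxn | hxn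
  · rcases H.side x hxn with hs | hs <;> intro e <;> linarith [hs.1]
  · obtain ⟨y, rfl⟩ : ∃ y, x = y + 1 := ⟨x - 1, by have := H.lt; omega⟩
    rcases H.side y hx with hs | hs <;> intro e <;> linarith [hs.2]

theorem not_cross_fst (H : IsPleat n j P h) {x : ℕ} (hx : x < n) (h1 : h (j - 1) < h x)
    (h2 : h x < h j) : (P x ≤ P j ∧ P (x + 1) ≤ P j) ∨ (P j ≤ P x ∧ P j ≤ P (x + 1)) := by
  have h3 := fun hm => H.layering.2.1 j H.one_le (by have := H.lt; omega) x hx hm (.inl ⟨h1, h2⟩)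
  rcases le_or_gt (P x) (P j) with h4 | h4 <;> rcases le_or_gt (P (x + 1)) (P j) with h5 | h5
  · exact .inl ⟨h4, h5⟩
  · refine .inr ⟨not_lt.1 fun h6 => h3 (.inl ⟨h6, h5⟩), h5.le⟩
  · refine .inr ⟨h4.le, not_lt.1 fun h6 => h3 (.inr ⟨h6, h4⟩)⟩
  · exact .inr ⟨h4.le, h5.le⟩

theorem not_cross_snd (H : IsPleat n j P h) {x : ℕ} (hx : x < n) (h1 : h j < h x)
    (h2 : h x < h (j + 1)) : (P x ≤ P (j + 1) ∧ P (x + 1) ≤ P (j + 1)) ∨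
      (P (j + 1) ≤ P x ∧ P (j + 1) ≤ P (x + 1)) := by
  have h3 := fun hm => H.layering.2.1 (j + 1) (by omega) H.lt x hx hm
    (.inl ⟨by simpa using h1, h2⟩)
  rcases le_or_gt (P x) (P (j + 1)) with h4 | h4 <;>
    rcases le_or_gt (P (x + 1)) (P (j + 1)) with h5 | h5
  · exact .inl ⟨h4, h5⟩
  · refine .inr ⟨not_lt.1 fun h6 => h3 (.inl ⟨h6, h5⟩), h5.le⟩
  · refine .inr ⟨h4.le, not_lt.1 fun h6 => h3 (.inr ⟨h6, h4⟩)⟩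
  · exact .inr ⟨h4.le, h5.le⟩

theorem not_entersLeft_and_entersRight (H : IsPleat n j P h) {x : ℕ} (hx : x < n) :
    ¬ (EntersLeft j P h x ∧ EntersRight j P h x) := by
  rintro ⟨h1 | h1, h2 | h2⟩
  · exact H.ne_succ hx (le_antisymm (h1.2.2.1.trans h2.2.2.2) (h1.2.2.2.trans h2.2.2.1))
  · omega
  · omega
  · exact H.ne_succ hx (le_antisymm (h1.2.2.1.trans h2.2.2.2) (h1.2.2.2.trans h2.2.2.1))

theorem height_ne (H : IsPleat n j P h) {x y : ℕ} (hx : x < n) (hy : y < n) (hxy : x ≠ y) :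
    h x ≠ h y := fun e => hxy (H.layering.1 x y hx hy e)

theorem entersLeft_or_entersRight (H : IsPleat n j P h) {x : ℕ} (hx : x < n) (hxj : x ≠ j)
    (h1 : h (j - 1) < h x) (h2 : h x < h (j + 1)) :
    EntersLeft j P h x ∨ EntersRight j P h x := by
  have := H.height_ne hx (by have := H.lt; omega : j < n) hxj
  rcases lt_or_gt_of_ne this with h3 | h3
  · rcases H.not_cross_fst hx h1 h3 with h4 | h4
    · exact .inl (.inl ⟨h1, h3, h4⟩)
    · exact .inr (.inl ⟨h1, h3, h4⟩)
  · rcases H.not_cross_snd hx h3 h2 with h4 | h4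
    · exact .inl (.inr ⟨h3, h2, h4⟩)
    · exact .inr (.inr ⟨h3, h2, h4⟩)

theorem not_between_of_mem (H : IsPleat n j P h) {i : ℕ} (hi : i + 1 < n)
    (h1 : P (j + 1) < P (i + 1)) (h2 : P (i + 1) < P j) :
    ¬ Between (fun a b => h a < h b) i (i + 1) (j - 1) ∧
      ¬ Between (fun a b => h a < h b) i (i + 1) j ∧
      ¬ Between (fun a b => h a < h b) i (i + 1) (j + 1) := by
  have hj := H.one_le
  have hjn := H.lt
  have e : j - 1 + 1 = j := by omega
  refine ⟨H.layering.2.1 (i + 1) (by omega) hi (j - 1) (by omega) ?_,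
    H.layering.2.1 (i + 1) (by omega) hi j (by omega) (.inr ⟨h1, h2⟩),
    H.layering.2.1 (i + 1) (by omega) hi (j + 1) (by omega)
      (.inl ⟨h1, h2.trans_le H.fst_le⟩)⟩
  rw [e]
  exact .inl ⟨H.le_snd.trans_lt h1, h2⟩

theorem entersRight_iff (H : IsPleat n j P h) {i : ℕ} (hi : i + 1 < n) (h1 : i + 1 ≠ j)
    (h2 : i ≠ j) (hp : P (i + 1) < P j) : EntersRight j P h i ↔ EntersRight j P h (i + 1) := by
  have hj := H.one_le
  have hjn := H.lt
  have q := H.snd_lt_fst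
  have hA := H.height_lt
  have hC := H.lt_height
  have h3 : i ≠ j + 1 := by
    rintro rfl
    exact absurd H.fst_le hp.not_ge
  have g1 := H.height_ne (show i < n by omega) (show j < n by omega) h2
  have g2 := H.height_ne hi (show j < n by omega) h1
  have g3 := H.height_ne (show i < n by omega) hjn h3
  have g4 := H.height_ne hi hjn (by omega : i + 1 ≠ j + 1)
  have s := H.side i hi
  rcases lt_trichotomy (P (i + 1)) (P (j + 1)) with hq | hq | hq
  · refine iff_of_false ?_ ?_
    · rintro (h4 | h4) <;> linarith [h4.2.2.2]
    · rintro (h4 | h4) <;> linarith [h4.2.2.1]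
  · have b := H.layering.2.2 (j + 1) (i + 1) (by omega) hjn (by omega) hi (by omega) hq.symm
    simp only [Between, Nat.add_sub_cancel] at b
    constructor
    · rintro (h4 | h4)
      · linarith [h4.2.2.2]
      · refine .inr ⟨by omega, by omega, hq.ge, ?_⟩
        rcases s with s | s <;> linarith [s.1, s.2, h4.2.2.1]
    · rintro (h4 | h4)
      · linarith [h4.2.2.1]
      · refine .inr ⟨by omega, by omega, ?_, hq.ge⟩
        have : P (i + 1 + 1) = P (i + 2) := rfl
        rcases s with s | s <;> linarith [s.1, s.2, h4.2.2.2]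
  · obtain ⟨-, b1, b2⟩ := H.not_between_of_mem hi hq hp
    simp only [Between] at b1 b2
    constructor
    · rintro (h4 | h4)
      · linarith [h4.2.2.2]
      · have h5 : h j < h (i + 1) := by omega
        have h6 : h (i + 1) < h (j + 1) := by omega
        refine .inr ⟨h5, h6, (H.not_cross_snd hi h5 h6).resolve_left fun h7 => ?_⟩
        linarith [h7.1]
    · rintro (h4 | h4)
      · linarith [h4.2.2.1]
      · have h5 : h j < h i := by omega
        have h6 : h i < h (j + 1) := by omega
        refine .inr ⟨h5, h6, (H.not_cross_snd (by omega) h5 h6).resolve_left fun h7 => ?_⟩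
        linarith [h7.2]

theorem entersLeft_iff (H : IsPleat n j P h) {i : ℕ} (hi : i + 1 < n) (h1 : i + 1 ≠ j)
    (h2 : i ≠ j) (hp : P (j + 1) < P (i + 1)) :
    EntersLeft j P h i ↔ EntersLeft j P h (i + 1) := by
  have hj := H.one_le
  have hjn := H.lt
  have q := H.snd_lt_fst
  have hA := H.height_lt
  have hC := H.lt_height
  have h3 : i + 1 ≠ j - 1 := by
    intro e
    rw [e] at hp
    exact absurd H.le_snd hp.not_ge
  have g1 := H.height_ne (show i < n by omega) (show j < n by omega) h2
  have g2 := H.height_ne hi (show j < n by omega) h1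
  have g3 := H.height_ne hi (show j - 1 < n by omega) h3
  have g4 := H.height_ne (show i < n by omega) (show j - 1 < n by omega) (by omega)
  have s := H.side i hi
  rcases lt_trichotomy (P (i + 1)) (P j) with hq | hq | hq
  · obtain ⟨b1, b2, -⟩ := H.not_between_of_mem hi hp hq
    simp only [Between] at b1 b2
    constructor
    · rintro (h4 | h4)
      · have h5 : h (j - 1) < h (i + 1) := by omega
        have h6 : h (i + 1) < h j := by omega
        refine .inl ⟨h5, h6, (H.not_cross_fst hi h5 h6).resolve_right fun h7 => ?_⟩
        linarith [h7.1]
      · linarith [h4.2.2.2]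
    · rintro (h4 | h4)
      · have h5 : h (j - 1) < h i := by omega
        have h6 : h i < h j := by omega
        refine .inl ⟨h5, h6, (H.not_cross_fst (by omega) h5 h6).resolve_right fun h7 => ?_⟩
        linarith [h7.2]
      · linarith [h4.2.2.1]
  · have b := H.layering.2.2 j (i + 1) hj (by omega) (by omega) hi (by omega) hq.symm
    simp only [Between, Nat.add_sub_cancel] at b
    constructor
    · rintro (h4 | h4)
      · refine .inl ⟨by omega, by omega, hq.le, ?_⟩
        rcases s with s | s <;> linarith [s.1, s.2, h4.2.2.1]
      · linarith [h4.2.2.2]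
    · rintro (h4 | h4)
      · refine .inl ⟨by omega, by omega, ?_, hq.le⟩
        have : P (i + 1 + 1) = P (i + 2) := rfl
        rcases s with s | s <;> linarith [s.1, s.2, h4.2.2.2]
      · linarith [h4.2.2.1]
  · refine iff_of_false ?_ ?_
    · rintro (h4 | h4) <;> linarith [h4.2.2.2]
    · rintro (h4 | h4) <;> linarith [h4.2.2.1]

open Classical in
/-- Heights for the monocrimped pattern: the layers entering the pleat from the right are put below
the merged layer, those entering from the left above it. -/
noncomputable def crimpHeight (j : ℕ) (P : ℕ → ℝ) (h : ℕ → ℤ) (x : ℕ) : ℤ :=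
  if x = j - 1 then h (j + 1)
  else if h (uncrimp j x) < h (j - 1) ∨ EntersRight j P h (uncrimp j x) then h (uncrimp j x)
  else h (uncrimp j x) + (h (j + 1) - h (j - 1))

/-- Comparison of `crimpHeight` with `h` when the merged layer is identified with `j - 1`. -/
theorem crimpHeight_left (H : IsPleat n j P h) (x : ℕ) :
    (EntersRight j P h (uncrimp j x) ∧ h (j - 1) < h (uncrimp j x) ∧
        h (uncrimp j x) < h (j + 1) ∧ crimpHeight j P h x = h (uncrimp j x)) ∨
      (¬ EntersRight j P h (uncrimp j x) ∧ h (uncrimp j x) < h (j - 1) ∧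
        crimpHeight j P h x = h (uncrimp j x)) ∨
      (¬ EntersRight j P h (uncrimp j x) ∧ h (j - 1) ≤ h (uncrimp j x) ∧
        crimpHeight j P h x = h (uncrimp j x) + (h (j + 1) - h (j - 1))) := by
  have hj := H.one_le
  have hA := H.height_lt
  have hC := H.lt_height
  by_cases hx : x = j - 1
  · have e : uncrimp j x = j - 1 := by simp only [uncrimp]; split_ifs <;> omega
    rw [e]
    refine .inr (.inr ⟨?_, le_rfl, ?_⟩)
    · rintro (h1 | h1) <;> omega
    · simp [crimpHeight, hx]
  · by_cases h1 : EntersRight j P h (uncrimp j x)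
    · refine .inl ⟨h1, ?_, ?_, by simp [crimpHeight, hx, h1]⟩
      · rcases h1 with h1 | h1 <;> omega
      · rcases h1 with h1 | h1 <;> omega
    · by_cases h2 : h (uncrimp j x) < h (j - 1)
      · exact .inr (.inl ⟨h1, h2, by simp [crimpHeight, hx, h2]⟩)
      · exact .inr (.inr ⟨h1, not_lt.1 h2, by simp [crimpHeight, hx, h1, h2]⟩)

/-- Comparison of `crimpHeight` with `h` when the merged layer is identified with `j + 1`. -/
theorem crimpHeight_right (H : IsPleat n j P h) {x : ℕ} (hxn : x < n - 2) :
    (EntersLeft j P h (uncrimp (j - 1) x) ∧ h (j - 1) < h (uncrimp (j - 1) x) ∧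
        h (uncrimp (j - 1) x) < h (j + 1) ∧
        crimpHeight j P h x = h (uncrimp (j - 1) x) + (h (j + 1) - h (j - 1))) ∨
      (¬ EntersLeft j P h (uncrimp (j - 1) x) ∧ h (uncrimp (j - 1) x) ≤ h (j + 1) ∧
        crimpHeight j P h x = h (uncrimp (j - 1) x)) ∨
      (¬ EntersLeft j P h (uncrimp (j - 1) x) ∧ h (j + 1) < h (uncrimp (j - 1) x) ∧
        crimpHeight j P h x = h (uncrimp (j - 1) x) + (h (j + 1) - h (j - 1))) := by
  have hj := H.one_le
  have hjn := H.lt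
  have hA := H.height_lt
  have hC := H.lt_height
  by_cases hx : x = j - 1
  · have e : uncrimp (j - 1) x = j + 1 := by simp only [uncrimp]; split_ifs <;> omega
    rw [e]
    refine .inr (.inl ⟨?_, le_rfl, ?_⟩)
    · rintro (h1 | h1) <;> omega
    · simp [crimpHeight, hx]
  · have e : uncrimp (j - 1) x = uncrimp j x := by simp only [uncrimp]; split_ifs <;> omega
    have e1 : uncrimp j x < n ∧ uncrimp j x ≠ j ∧ uncrimp j x ≠ j - 1 ∧ uncrimp j x ≠ j + 1 := by
      simp only [uncrimp]; split_ifs <;> omega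
    rw [e]
    have g1 := H.height_ne e1.1 (show j - 1 < n by omega) e1.2.2.1
    have g2 := H.height_ne e1.1 hjn e1.2.2.2
    have g3 := H.entersLeft_or_entersRight e1.1 e1.2.1
    have g4 := H.not_entersLeft_and_entersRight e1.1
    rcases H.crimpHeight_left x with ⟨h1, h2, h3, h4⟩ | ⟨h1, h2, h3⟩ | ⟨h1, h2, h3⟩
    · exact .inr (.inl ⟨fun h5 => g4 ⟨h5, h1⟩, h3.le, h4⟩)
    · refine .inr (.inl ⟨?_, by omega, h3⟩)
      rintro (h4 | h4) <;> omega
    · rcases lt_or_gt_of_ne g2 with h4 | h4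
      · exact .inl ⟨(g3 (by omega) h4).resolve_right h1, by omega, h4, h3⟩
      · refine .inr (.inr ⟨?_, h4, h3⟩)
        rintro (h5 | h5) <;> omega

theorem isGapMap_left (H : IsPleat n j P h) :
    IsGapMap (n - 2) (crimpHeight j P h) (fun x => h (uncrimp j x))
      (fun x => EntersRight j P h (uncrimp j x)) (h (j - 1)) (h (j + 1)) := by
  have hA := H.height_lt
  have hC := H.lt_height
  refine ⟨fun x _ hq => ?_, fun x _ hq => ?_, fun x y _ _ hq => ?_⟩
  · rcases H.crimpHeight_left x with h1 | h1 | h1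
    · omega
    · exact absurd hq h1.1
    · exact absurd hq h1.1
  · rcases H.crimpHeight_left x with h1 | h1 | h1
    · exact absurd h1.1 hq
    · omega
    · omega
  · rcases H.crimpHeight_left x with h1 | h1 | h1 <;>
      rcases H.crimpHeight_left y with h2 | h2 | h2 <;>
      first | (exfalso; tauto) | (clear hq; omega)

theorem isGapMap_right (H : IsPleat n j P h) :
    IsGapMap (n - 2) (crimpHeight j P h) (fun x => h (uncrimp (j - 1) x))
      (fun x => EntersLeft j P h (uncrimp (j - 1) x)) (h (j + 1))
      (h (j + 1) + (h (j + 1) - h (j - 1))) := by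
  have hA := H.height_lt
  have hC := H.lt_height
  refine ⟨fun x hx hq => ?_, fun x hx hq => ?_, fun x y hx hy hq => ?_⟩
  · rcases H.crimpHeight_right hx with h1 | h1 | h1
    · omega
    · exact absurd hq h1.1
    · exact absurd hq h1.1
  · rcases H.crimpHeight_right hx with h1 | h1 | h1
    · exact absurd h1.1 hq
    · omega
    · omega
  · rcases H.crimpHeight_right hx with h1 | h1 | h1 <;>
      rcases H.crimpHeight_right hy with h2 | h2 | h2 <;>
      first | (exfalso; tauto) | (clear hq; omega)

/-- Vertices of the new pattern to the left of the fold at `j` are read in the identification of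
the merged layer with `j - 1`. -/
theorem uncrimp_left (H : IsPleat n j P h) {i : ℕ} (hi : 1 ≤ i) (hin : i < n - 2)
    (hp : P (uncrimp j i) < P j) :
    ∃ e, uncrimp j (i - 1) = e ∧ uncrimp j i = e + 1 ∧ e + 1 < n ∧ e + 1 ≠ j ∧ e ≠ j ∧
      (EntersRight j P h e ↔ EntersRight j P h (e + 1)) := by
  have hij : i ≠ j := by
    rintro rfl
    simp only [uncrimp, lt_irrefl, if_false] at hp
    exact absurd H.fst_le hp.not_ge
  have h1 : uncrimp j i = uncrimp j (i - 1) + 1 ∧ uncrimp j (i - 1) + 1 < n ∧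
      uncrimp j (i - 1) + 1 ≠ j ∧ uncrimp j (i - 1) ≠ j := by
    simp only [uncrimp]; split_ifs <;> omega
  exact ⟨_, rfl, h1.1, h1.2.1, h1.2.2.1, h1.2.2.2,
    H.entersRight_iff h1.2.1 h1.2.2.1 h1.2.2.2 (h1.1 ▸ hp)⟩

/-- Vertices of the new pattern to the right of the fold at `j + 1` are read in the identification
of the merged layer with `j + 1`. -/
theorem uncrimp_right (H : IsPleat n j P h) {i : ℕ} (hi : 1 ≤ i) (hin : i < n - 2)
    (hp : P (j + 1) < P (uncrimp j i)) :
    ∃ e, uncrimp (j - 1) (i - 1) = e ∧ uncrimp (j - 1) i = e + 1 ∧ uncrimp j i = e + 1 ∧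
      e + 1 < n ∧ e + 1 ≠ j ∧ e ≠ j ∧ (EntersLeft j P h e ↔ EntersLeft j P h (e + 1)) := by
  have hj := H.one_le
  have hij : i ≠ j - 1 := by
    rintro rfl
    have : j - 1 < j := by omega
    simp only [uncrimp, this, if_true] at hp
    exact absurd H.le_snd hp.not_ge
  have h1 : uncrimp (j - 1) i = uncrimp (j - 1) (i - 1) + 1 ∧
      uncrimp j i = uncrimp (j - 1) (i - 1) + 1 ∧ uncrimp (j - 1) (i - 1) + 1 < n ∧
      uncrimp (j - 1) (i - 1) + 1 ≠ j ∧ uncrimp (j - 1) (i - 1) ≠ j := by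
    simp only [uncrimp]; split_ifs <;> omega
  exact ⟨_, rfl, h1.1, h1.2.1, h1.2.2.1, h1.2.2.2.1, h1.2.2.2.2,
    H.entersLeft_iff h1.2.2.1 h1.2.2.2.1 h1.2.2.2.2 (h1.2.1 ▸ hp)⟩

theorem crimpHeight_inj (H : IsPleat n j P h) {a b : ℕ} (ha : a < n - 2) (hb : b < n - 2)
    (hab : crimpHeight j P h a = crimpHeight j P h b) : a = b := by
  have hA := H.height_lt
  have hC := H.lt_height
  have h3 : h (uncrimp j a) = h (uncrimp j b) := by
    rcases H.crimpHeight_left a with h1 | h1 | h1 <;>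
      rcases H.crimpHeight_left b with h2 | h2 | h2 <;> omega
  have h4 := H.layering.1 _ _ (by simp only [uncrimp]; split_ifs <;> omega)
    (by simp only [uncrimp]; split_ifs <;> omega) h3
  simp only [uncrimp] at h4
  split_ifs at h4 <;> omega

theorem not_between_crimpHeight_left (H : IsPleat n j P h) {i k : ℕ} (hi : 1 ≤ i)
    (hin : i < n - 2) (hk : k < n - 2) (hp : P (uncrimp j i) < P j)
    (hmem : (P (uncrimp j k) < P (uncrimp j i) ∧ P (uncrimp j i) < P (uncrimp j (k + 1))) ∨
      (P (uncrimp j (k + 1)) < P (uncrimp j i) ∧ P (uncrimp j i) < P (uncrimp j k))) :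
    ¬ Between (fun a b => crimpHeight j P h a < crimpHeight j P h b) (i - 1) i k := by
  have hj := H.one_le
  have hjn := H.lt
  obtain ⟨e, e1, e2, hen, hej, hej', hQ⟩ := H.uncrimp_left hi hin hp
  have hkn : uncrimp j k < n := by simp only [uncrimp]; split_ifs <;> omega
  rw [e2] at hmem hp
  have hmem' : (P (uncrimp j k) < P (e + 1) ∧ P (e + 1) < P (uncrimp j k + 1)) ∨
      (P (uncrimp j k + 1) < P (e + 1) ∧ P (e + 1) < P (uncrimp j k)) := by
    by_cases hkj : k = j - 1
    · have u1 : uncrimp j k = j - 1 := by simp only [uncrimp]; split_ifs <;> omega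
      have u2 : uncrimp j (k + 1) = j + 2 := by simp only [uncrimp]; split_ifs <;> omega
      have u3 : j - 1 + 1 = j := by omega
      rw [u1, u2] at hmem
      rw [u1, u3]
      have := H.le_snd
      have := H.snd_lt_fst
      have := H.fst_le
      rcases hmem with hm | hm
      · exact .inl ⟨hm.1, hp⟩
      · linarith [hm.1, hm.2]
    · have u1 : uncrimp j (k + 1) = uncrimp j k + 1 := by
        simp only [uncrimp]; split_ifs <;> omega
      rwa [u1] at hmem
  refine H.isGapMap_left.not_between (by omega) hin hk (by rw [e1, e2]; exact hQ) ?_ ?_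
  · have := H.layering.2.1 (e + 1) (by omega) hen (uncrimp j k) hkn hmem'
    simpa only [Between, e1, e2, Nat.add_sub_cancel] using this
  · intro q1 q2 q3
    have hgt : P (j + 1) < P (e + 1) := by
      rcases q1 with q1 | q1 <;> rcases hmem' with hm | hm <;>
        linarith [hm.1, hm.2, q1.2.2.1, q1.2.2.2]
    have nb := (H.not_between_of_mem hen hgt hp).1
    have n1 := H.height_ne hen (show j - 1 < n by omega) (by
      intro e3
      rw [e3] at hgt
      exact absurd H.le_snd hgt.not_ge)
    have n2 := H.height_ne (show e < n by omega) (show j - 1 < n by omega) (by omega)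
    have c1 := H.crimpHeight_left (i - 1)
    have c2 := H.crimpHeight_left i
    have hA := H.height_lt
    have hC := H.lt_height
    rw [e1] at c1 q2
    rw [e2] at c2 q3
    replace c1 := c1.resolve_left fun c => q2 c.1
    replace c2 := c2.resolve_left fun c => q3 c.1
    simp only [Between] at nb
    omega

theorem not_between_crimpHeight_right (H : IsPleat n j P h) {i k : ℕ} (hi : 1 ≤ i)
    (hin : i < n - 2) (hk : k < n - 2) (hp : P (j + 1) < P (uncrimp j i))
    (hmem : (P (uncrimp j k) < P (uncrimp j i) ∧ P (uncrimp j i) < P (uncrimp j (k + 1))) ∨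
      (P (uncrimp j (k + 1)) < P (uncrimp j i) ∧ P (uncrimp j i) < P (uncrimp j k))) :
    ¬ Between (fun a b => crimpHeight j P h a < crimpHeight j P h b) (i - 1) i k := by
  have hj := H.one_le
  have hjn := H.lt
  obtain ⟨e, e1, e2, e3, hen, hej, hej', hQ⟩ := H.uncrimp_right hi hin hp
  have hkn : uncrimp (j - 1) k < n := by simp only [uncrimp]; split_ifs <;> omega
  rw [e3] at hmem hp
  have hmem' : (P (uncrimp (j - 1) k) < P (e + 1) ∧ P (e + 1) < P (uncrimp (j - 1) k + 1)) ∨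
      (P (uncrimp (j - 1) k + 1) < P (e + 1) ∧ P (e + 1) < P (uncrimp (j - 1) k)) := by
    by_cases hkj : k = j - 1
    · have u1 : uncrimp j k = j - 1 := by simp only [uncrimp]; split_ifs <;> omega
      have u2 : uncrimp j (k + 1) = j + 2 := by simp only [uncrimp]; split_ifs <;> omega
      have u3 : uncrimp (j - 1) k = j + 1 := by simp only [uncrimp]; split_ifs <;> omega
      have u4 : j + 1 + 1 = j + 2 := rfl
      rw [u1, u2] at hmem
      rw [u3, u4]
      have := H.le_snd
      have := H.snd_lt_fst
      have := H.fst_le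
      rcases hmem with hm | hm
      · exact .inl ⟨hp, hm.2⟩
      · linarith [hm.1, hm.2]
    · have u1 : uncrimp j (k + 1) = uncrimp (j - 1) k + 1 := by
        simp only [uncrimp]; split_ifs <;> omega
      have u2 : uncrimp j k = uncrimp (j - 1) k := by
        simp only [uncrimp]; split_ifs <;> omega
      rwa [u1, u2] at hmem
  refine H.isGapMap_right.not_between (by omega) hin hk (by rw [e1, e2]; exact hQ) ?_ ?_
  · have := H.layering.2.1 (e + 1) (by omega) hen (uncrimp (j - 1) k) hkn hmem'
    simpa only [Between, e1, e2, Nat.add_sub_cancel] using this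
  · intro q1 q2 q3
    have hlt : P (e + 1) < P j := by
      have := H.snd_lt_fst
      rcases q1 with q1 | q1 <;> rcases hmem' with hm | hm <;>
        linarith [hm.1, hm.2, q1.2.2.1, q1.2.2.2]
    have nb := (H.not_between_of_mem hen hp hlt).2.2
    have n1 := H.height_ne (show e < n by omega) hjn (by
      intro e4
      rw [e4] at hlt
      exact absurd H.fst_le hlt.not_ge)
    have n2 := H.height_ne hen hjn (by omega)
    have c1 := H.crimpHeight_right (show i - 1 < n - 2 by omega)
    have c2 := H.crimpHeight_right hin
    have hA := H.height_lt
    have hC := H.lt_height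
    rw [e1] at c1 q2
    rw [e2] at c2 q3
    replace c1 := c1.resolve_left fun c => q2 c.1
    replace c2 := c2.resolve_left fun c => q3 c.1
    simp only [Between] at nb
    omega

theorem between_crimpHeight_iff (H : IsPleat n j P h) {i k : ℕ} (hi : 1 ≤ i)
    (hin : i < n - 2) (hk : 1 ≤ k) (hkn : k < n - 2) (hik : i ≠ k)
    (hP : P (uncrimp j i) = P (uncrimp j k)) :
    Between (fun a b => crimpHeight j P h a < crimpHeight j P h b) (i - 1) i (k - 1) ↔
      Between (fun a b => crimpHeight j P h a < crimpHeight j P h b) (i - 1) i k := by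
  have hne : uncrimp j i ≠ uncrimp j k := by
    simp only [uncrimp]; split_ifs <;> omega
  rcases lt_or_ge (P (uncrimp j i)) (P j) with hp | hp
  · obtain ⟨e, e1, e2, hen, -, -, hQ⟩ := H.uncrimp_left hi hin hp
    obtain ⟨f, f1, f2, hfn, -, -, hQ'⟩ := H.uncrimp_left hk hkn (hP ▸ hp)
    refine H.isGapMap_left.between_iff_between (by omega) hin (by omega) hkn
      (by rw [e1, e2]; exact hQ) (by rw [f1, f2]; exact hQ') ?_
    have := H.layering.2.2 (e + 1) (f + 1) (by omega) hen (by omega) hfn (by omega)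
      (by rw [← e2, ← f2, hP])
    simpa only [Between, e1, e2, f1, f2, Nat.add_sub_cancel] using this
  · replace hp := H.snd_lt_fst.trans_le hp
    obtain ⟨e, e1, e2, e3, hen, -, -, hQ⟩ := H.uncrimp_right hi hin hp
    obtain ⟨f, f1, f2, f3, hfn, -, -, hQ'⟩ := H.uncrimp_right hk hkn (hP ▸ hp)
    refine H.isGapMap_right.between_iff_between (by omega) hin (by omega) hkn
      (by rw [e1, e2]; exact hQ) (by rw [f1, f2]; exact hQ') ?_
    have := H.layering.2.2 (e + 1) (f + 1) (by omega) hen (by omega) hfn (by omega)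
      (by rw [← e3, ← f3, hP])
    simpa only [Between, e1, e2, f1, f2, Nat.add_sub_cancel] using this

theorem crimpHeight_lt_iff (H : IsPleat n j P h) {i : ℕ} (hi : 1 ≤ i) (hin : i < n - 2) :
    crimpHeight j P h (i - 1) < crimpHeight j P h i ↔
      h (uncrimp j i - 1) < h (uncrimp j i) := by
  rcases lt_or_ge (P (uncrimp j i)) (P j) with hp | hp
  · obtain ⟨e, e1, e2, -, -, -, hQ⟩ := H.uncrimp_left hi hin hp
    rw [H.isGapMap_left.lt_iff _ _ (by omega) hin (by rw [e1, e2]; exact hQ), e1, e2,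
      Nat.add_sub_cancel]
  · obtain ⟨e, e1, e2, e3, -, -, -, hQ⟩ := H.uncrimp_right hi hin (H.snd_lt_fst.trans_le hp)
    rw [H.isGapMap_right.lt_iff _ _ (by omega) hin (by rw [e1, e2]; exact hQ), e1, e2, e3,
      Nat.add_sub_cancel]

theorem isLayering_crimpHeight (H : IsPleat n j P h) :
    IsLayering (n - 2) (fun k => P (uncrimp j k)) (crimpHeight j P h) := by
  refine ⟨fun a b ha hb => H.crimpHeight_inj ha hb, fun i hi hin k hk hmem => ?_,
    fun i k hi hin hk hkn hik hP => H.between_crimpHeight_iff hi hin hk hkn hik hP⟩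
  rcases lt_or_ge (P (uncrimp j i)) (P j) with hp | hp
  · exact H.not_between_crimpHeight_left hi hin hk hp hmem
  · exact H.not_between_crimpHeight_right hi hin hk (H.snd_lt_fst.trans_le hp) hmem

end IsPleat

/-- The folding of a crease pattern reverses direction at every crease. -/
theorem foldCrease_side {n : ℕ} {c : ℕ → ℝ} (hC : IsCreasePattern n c) (i : ℕ) (hi : i + 1 < n) :
    (foldCrease c i < foldCrease c (i + 1) ∧ foldCrease c (i + 2) < foldCrease c (i + 1)) ∨
      (foldCrease c (i + 1) < foldCrease c i ∧
        foldCrease c (i + 1) < foldCrease c (i + 2)) := by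
  have h1 := hC.2 i (i + 1) (by omega) (by omega)
  have h2 := hC.2 (i + 1) (i + 2) (by omega) (by omega)
  rw [foldCrease_succ c (i + 1), foldCrease_succ c i, pow_succ]
  rcases neg_one_pow_eq_or ℝ i with h3 | h3 <;> rw [h3]
  · left; constructor <;> linarith
  · right; constructor <;> linarith

/-- A layering of the original pattern in which the crimped creases have opposite type induces
one of the monocrimped pattern, and conversely. -/
theorem exists_isLayering_iff_uncrimp {n j : ℕ} {P : ℕ → ℝ} (S : ℕ → Prop) (hj : 1 ≤ j)
    (hjn : j + 1 < n) (h0 : P (j - 1) ≤ P (j + 1)) (h1 : P (j + 1) < P j) (h2 : P j ≤ P (j + 2))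
    (hside : ∀ i, i + 1 < n →
      (P i < P (i + 1) ∧ P (i + 2) < P (i + 1)) ∨ (P (i + 1) < P i ∧ P (i + 1) < P (i + 2)))
    (hS : S j ↔ S (j + 1)) :
    (∃ h, IsLayering n P h ∧ ∀ i, 1 ≤ i → i < n → (h (i - 1) < h i ↔ S i)) ↔
      ∃ h, IsLayering (n - 2) (fun k => P (uncrimp j k)) h ∧
        ∀ i, 1 ≤ i → i < n - 2 → (h (i - 1) < h i ↔ S (uncrimp j i)) := by
  have hu : ∀ i, 1 ≤ i → i < n - 2 → 1 ≤ uncrimp j i ∧ uncrimp j i < n := by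
    intro i hi hin; simp only [uncrimp]; split_ifs <;> omega
  constructor
  · rintro ⟨h, H, hm⟩
    have m1 := hm j hj (by omega)
    have m2 := hm (j + 1) (by omega) hjn
    rw [Nat.add_sub_cancel] at m2
    by_cases hs : S j
    · have Q : IsPleat n j P h :=
        ⟨hj, hjn, h0, h1, h2, hside, H, m1.2 hs, m2.2 (hS.1 hs)⟩
      refine ⟨_, Q.isLayering_crimpHeight, fun i hi hin => ?_⟩
      rw [Q.crimpHeight_lt_iff hi hin, hm _ (hu i hi hin).1 (hu i hi hin).2]
    · have n1 : h (j - 1) ≠ h j := fun e => by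
        have := H.1 _ _ (by omega) (by omega) e; omega
      have n2 : h j ≠ h (j + 1) := fun e => by
        have := H.1 _ _ (by omega) (by omega) e; omega
      have Q : IsPleat n j P (fun k => -h k) :=
        ⟨hj, hjn, h0, h1, h2, hside, H.neg_right,
          neg_lt_neg (lt_of_le_of_ne (not_lt.1 (mt m1.1 hs)) n1.symm),
          neg_lt_neg (lt_of_le_of_ne (not_lt.1 (mt m2.1 (mt hS.2 hs))) n2.symm)⟩
      refine ⟨_, Q.isLayering_crimpHeight.neg_right, fun i hi hin => ?_⟩
      have hc := Q.crimpHeight_lt_iff hi hin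
      have k1 : IsPleat.crimpHeight j P (fun k => -h k) (i - 1) ≠
          IsPleat.crimpHeight j P (fun k => -h k) i :=
        fun e => by have := Q.crimpHeight_inj (by omega) hin e; omega
      have k2 : h (uncrimp j i - 1) ≠ h (uncrimp j i) := fun e => by
        have := hu i hi hin
        have := H.1 _ _ (by omega) (by omega) e
        omega
      rw [← hm _ (hu i hi hin).1 (hu i hi hin).2]
      omega
  · rintro ⟨h, H, hm⟩
    have split : ∀ i, 1 ≤ i → i < n → i = j ∨ i = j + 1 ∨
        ∃ e, 1 ≤ e ∧ e < n - 2 ∧ uncrimp j e = i := by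
      intro i hi hin
      by_cases a : i = j
      · exact .inl a
      by_cases b : i = j + 1
      · exact .inr (.inl b)
      refine .inr (.inr ⟨if i < j then i else i - 2, ?_⟩)
      simp only [uncrimp]
      split_ifs <;> omega
    by_cases hs : S j
    · obtain ⟨g, G, g1, g2, g3⟩ := H.of_uncrimp hj hjn h0 h1 h2
      refine ⟨g, G, fun i hi hin => ?_⟩
      rcases split i hi hin with rfl | rfl | ⟨e, he, hen, rfl⟩
      · exact iff_of_true g1 hs
      · exact iff_of_true g2 (hS.1 hs)
      · rw [g3 e he hen, hm e he hen]
    · obtain ⟨g, G, g1, g2, g3⟩ := H.neg_right.of_uncrimp hj hjn h0 h1 h2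
      refine ⟨_, G.neg_right, fun i hi hin => ?_⟩
      rcases split i hi hin with rfl | rfl | ⟨e, he, hen, rfl⟩
      · exact iff_of_false (by omega) hs
      · exact iff_of_false (by simp only [Nat.add_sub_cancel]; omega) (mt hS.2 hs)
      · have := g3 e he hen
        have k1 : g (uncrimp j e - 1) ≠ g (uncrimp j e) := fun e1 => by
          have := G.1 _ _ (by omega) (by omega) e1
          omega
        have k2 : h (e - 1) ≠ h e := fun e1 => by
          have := H.1 _ _ (by omega) (by omega) e1
          omega
        rw [← hm e he hen]
        omega

/-- Let `(C, μ)` be an MV pattern and `(c j, c (j+1))` an adjacent pair of creases of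
opposite μ-value whose neighboring intervals are at least as long as the middle one.
Then `(C, μ)` is flat-foldable iff the pattern produced by the monocrimp at
`(c j, c (j+1))` — with the induced assignment on its remaining creases — is flat-foldable. -/
theorem monocrimp_preserves_foldability (n : ℕ) (c : ℕ → ℝ) (μ : ℕ → MV)
    (hC : IsCreasePattern n c)
    (j : ℕ) (hj1 : 1 ≤ j) (hj2 : j + 1 ≤ n - 1)
    (hl : c (j + 1) - c j ≤ c j - c (j - 1))
    (hr : c (j + 1) - c j ≤ c (j + 2) - c (j + 1))
    (hμ : μ j ≠ μ (j + 1)) :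
    IsFlatFoldable n c μ ↔
      IsFlatFoldable (n - 2) (monocrimpPattern c j)
        (fun x => if x < j then μ x else μ (x + 2)) := by
  have hn : j + 1 < n := by omega
  have hd := hC.2 j (j + 1) (by omega) (by omega)
  rw [isFlatFoldable_iff_exists_isLayering, isFlatFoldable_iff_exists_isLayering,
    foldCrease_monocrimpPattern c j hj1]
  let S : ℕ → Prop := fun i => (μ i = MV.V ∧ Even (i - 1)) ∨ (μ i = MV.M ∧ Odd (i - 1))
  have hS : S j ↔ S (j + 1) := by
    have hpar : Even j ↔ Odd (j - 1) := by
      obtain ⟨i, rfl⟩ : ∃ i, j = i + 1 := ⟨j - 1, by omega⟩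
      simp [Nat.even_add_one]
    simp only [S, Nat.add_sub_cancel, ← Nat.not_even_iff_odd] at hpar ⊢
    cases h1 : μ j <;> cases h2 : μ (j + 1) <;> simp_all
  have hSu : ∀ i, 1 ≤ i → (((if i < j then μ i else μ (i + 2)) = MV.V ∧ Even (i - 1)) ∨
      ((if i < j then μ i else μ (i + 2)) = MV.M ∧ Odd (i - 1)) ↔ S (uncrimp j i)) := by
    intro i hi
    obtain ⟨k, rfl⟩ : ∃ k, i = k + 1 := ⟨i - 1, by omega⟩
    by_cases hk : k + 1 < j
    · simp [S, uncrimp, hk]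
    · have : k + 1 + 2 - 1 = k + 2 := rfl
      simp [S, uncrimp, hk, this, Nat.even_add, Nat.odd_add]
  have hmain : (∃ h, IsLayering n (foldCrease c) h ∧
      ∀ i, 1 ≤ i → i < n → (h (i - 1) < h i ↔ S i)) ↔
      ∃ h, IsLayering (n - 2) (fun k => foldCrease c (uncrimp j k)) h ∧
        ∀ i, 1 ≤ i → i < n - 2 → (h (i - 1) < h i ↔ S (uncrimp j i)) := by
    have hside := foldCrease_side hC
    have e0 : j - 1 + 1 = j := by omega
    have s0 := foldCrease_succ c (j - 1)
    have s1 := foldCrease_succ c j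
    have s2 := foldCrease_succ c (j + 1)
    have p1 : (-1 : ℝ) ^ j = -(-1) ^ (j - 1) := by
      conv_lhs => rw [← e0]
      rw [pow_succ]; ring
    rw [e0] at s0
    rw [pow_succ, p1] at s2
    rw [p1] at s1
    rcases neg_one_pow_eq_or ℝ (j - 1) with p | p <;> rw [p] at s0 s1 s2
    · exact exists_isLayering_iff_uncrimp S hj1 hn (by linarith) (by linarith) (by linarith)
        hside hS
    · have hneg : ∀ (m : ℕ) (P : ℕ → ℝ) (h : ℕ → ℤ),
          IsLayering m P h ↔ IsLayering m (fun k => -P k) h := fun m P h =>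
        ⟨fun H => H.neg_left, fun H => by simpa only [neg_neg] using H.neg_left⟩
      simp only [hneg _ (foldCrease c), hneg _ (fun k => foldCrease c (uncrimp j k))]
      refine exists_isLayering_iff_uncrimp (P := fun k => -foldCrease c k) S hj1 hn
        (by linarith) (by linarith) (by linarith) (fun i hi => ?_) hS
      simp only [neg_lt_neg_iff]
      exact (hside i hi).symm
  refine hmain.trans (exists_congr fun h => and_congr_right fun _ => ?_)
  exact forall_congr' fun i => forall_congr' fun hi => forall_congr' fun _ => by rw [← hSu i hi]
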